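/- arXiv:1608.06041 — 2 statements merged into one kernel-verified Lean document; each statement's English description precedes it below -/
import Mathlib

section
/- Let f(ξ) = (1/2)·ln(1 + ξ/N_D) + (1/2)·ln(1 + ε·ξ/N_U) − ln(1 + ξ/(RSI_D + N_D)) − ln(1 + ε·ξ/(RSI_U + N_U)) for ξ ≥ 0. If RSI_D ≥ N_D, RSI_U ≥ N_U, and at least one of these two inequalities is strict, then f is differentiable on [0,∞) and there exists ξ₀ > 0 such that f′(ξ) > 0 for all ξ ∈ [0, ξ₀). -/
open Real Set

theorem hasDerivAt_log_one_add_mul_div {c N ξ : ℝ} (hc : 0 ≤ c) (hN : 0 < N) (hξ : 0 ≤ ξ) :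
    HasDerivAt (fun x => Real.log (1 + c * x / N)) (c / (N + c * ξ)) ξ := by
  have hpos : 0 < 1 + c * ξ / N := by positivity
  have hpos' : 0 < N + c * ξ := by positivity
  have hslope : c / (N + c * ξ) = c * 1 / N / (1 + c * ξ / N) := by field_simp
  rw [hslope]
  exact ((((hasDerivAt_id ξ).const_mul c).div_const N).const_add 1).log hpos.ne'

/-- With `f` the half-duplex minus full-duplex rate difference, if
`RSI_D ≥ N_D`, `RSI_U ≥ N_U` with at least one strict, then `f` is differentiable on
`[0,∞)` and its derivative is positive on some initial interval `[0, ξ₀)`. -/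
theorem hybrid_duplex_deriv_pos_near_zero
    (ND NU RD RU ε : ℝ) (hND : 0 < ND) (hNU : 0 < NU) (hRD : 0 ≤ RD) (hRU : 0 ≤ RU)
    (hε : 0 < ε) (hD : ND ≤ RD) (hU : NU ≤ RU) (hstrict : ND < RD ∨ NU < RU)
    (f : ℝ → ℝ)
    (hf : f = fun ξ => (1/2) * Real.log (1 + ξ / ND) + (1/2) * Real.log (1 + ε * ξ / NU)
      - Real.log (1 + ξ / (RD + ND)) - Real.log (1 + ε * ξ / (RU + NU))) :
    DifferentiableOn ℝ f (Set.Ici 0) ∧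
      ∃ ξ₀ > 0, ∀ ξ, 0 ≤ ξ → ξ < ξ₀ → 0 < deriv f ξ := by
  have hderiv : ∀ ξ, 0 ≤ ξ → HasDerivAt f (1 / 2 * (1 / (ND + 1 * ξ)) + 1 / 2 * (ε / (NU + ε * ξ))
      - 1 / (RD + ND + 1 * ξ) - ε / (RU + NU + ε * ξ)) ξ := by
    intro ξ hξ
    have h := ((((hasDerivAt_log_one_add_mul_div zero_le_one hND hξ).const_mul (1 / 2)).add
      ((hasDerivAt_log_one_add_mul_div hε.le hNU hξ).const_mul (1 / 2))).sub
      (hasDerivAt_log_one_add_mul_div zero_le_one (add_pos_of_nonneg_of_pos hRD hND) hξ)).sub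
      (hasDerivAt_log_one_add_mul_div hε.le (add_pos_of_nonneg_of_pos hRU hNU) hξ)
    rw [hf]
    refine h.congr_of_eventuallyEq (.of_forall fun x => ?_)
    simp only [Pi.add_apply, Pi.sub_apply, one_mul]
  refine ⟨fun ξ hξ => (hderiv ξ hξ).differentiableAt.differentiableWithinAt, ?_⟩
  have hcont : ContinuousAt (fun ξ => 1 / 2 * (1 / (ND + 1 * ξ)) + 1 / 2 * (ε / (NU + ε * ξ))
      - 1 / (RD + ND + 1 * ξ) - ε / (RU + NU + ε * ξ)) 0 := by
    fun_prop (disch := simp only [mul_zero, add_zero]; positivity)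
  have hzero : 0 < 1 / 2 * (1 / (ND + 1 * 0)) + 1 / 2 * (ε / (NU + ε * 0))
      - 1 / (RD + ND + 1 * 0) - ε / (RU + NU + ε * 0) := by
    have hsplit : 1 / 2 * (1 / (ND + 1 * 0)) + 1 / 2 * (ε / (NU + ε * 0))
        - 1 / (RD + ND + 1 * 0) - ε / (RU + NU + ε * 0)
        = (RD - ND) / (2 * ND * (RD + ND)) + ε * (RU - NU) / (2 * NU * (RU + NU)) := by
      have := add_pos_of_nonneg_of_pos hRD hND
      have := add_pos_of_nonneg_of_pos hRU hNU
      simp only [mul_zero, add_zero]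
      field_simp
      ring
    rw [hsplit]
    have hD' := sub_nonneg.2 hD
    have hU' := sub_nonneg.2 hU
    rcases hstrict with h | h
    · have := sub_pos.2 h
      positivity
    · have := sub_pos.2 h
      positivity
  obtain ⟨δ, hδ, hball⟩ := Metric.eventually_nhds_iff.1 (hcont.eventually_const_lt hzero)
  refine ⟨δ, hδ, fun ξ hξ hξδ => ?_⟩
  rw [(hderiv ξ hξ).deriv]
  exact hball (by rwa [Real.dist_eq, sub_zero, abs_of_nonneg hξ])
end

section
/- Let f(ξ) = (1/2)·ln(1 + ξ/N_D) + (1/2)·ln(1 + ε·ξ/N_U) − ln(1 + ξ/(RSI_D + N_D)) − ln(1 + ε·ξ/(RSI_U + N_U)) for ξ ≥ 0. If RSI_D ≥ N_D, RSI_U ≥ N_U, and at least one of these two inequalities is strict, then there exists ξ₀ > 0 such that f(ξ) > 0 for all ξ ∈ (0, ξ₀); that is, a user with sufficiently low received signal power achieves a strictly higher rate in half-duplex mode than in full-duplex mode. -/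
open Real Set

lemma hasDerivAt_log_one_add_mul_div_zero (a b : ℝ) :
    HasDerivAt (fun x : ℝ => Real.log (1 + a * x / b)) (a / b) 0 := by
  have h : HasDerivAt (fun x : ℝ => 1 + a * x / b) (a / b) 0 := by
    simpa using (((hasDerivAt_id (0 : ℝ)).const_mul a).div_const b).const_add 1
  simpa using h.log (by simp)

lemma exists_pos_forall_pos_of_hasDerivAt_zero {f : ℝ → ℝ} {d : ℝ} (h : HasDerivAt f d 0)
    (h₀ : f 0 = 0) (hd : 0 < d) : ∃ r > 0, ∀ x, 0 < x → x < r → 0 < f x := by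
  have h_slope := h.hasDerivWithinAt (s := Ioi 0)
  rw [hasDerivWithinAt_iff_tendsto_slope' (by simp)] at h_slope
  obtain ⟨r, hr, hsub⟩ := mem_nhdsGT_iff_exists_Ioo_subset.mp (h_slope.eventually_const_lt hd)
  refine ⟨r, hr, fun x hx hxr => ?_⟩
  have h_pos : 0 < slope f 0 x := hsub ⟨hx, hxr⟩
  rw [slope_def_field, h₀, sub_zero, sub_zero] at h_pos
  exact (div_pos_iff_of_pos_right hx).mp h_pos

lemma div_add_le_half_mul_div {a b c : ℝ} (ha : 0 < a) (hb : 0 < b) (h : b ≤ c) :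
    a / (c + b) ≤ 1 / 2 * (a / b) := by
  rw [show 1 / 2 * (a / b) = a / (b + b) by field_simp; ring]
  gcongr

lemma div_add_lt_half_mul_div {a b c : ℝ} (ha : 0 < a) (hb : 0 < b) (h : b < c) :
    a / (c + b) < 1 / 2 * (a / b) := by
  rw [show 1 / 2 * (a / b) = a / (b + b) by field_simp; ring]
  gcongr

/-- With `f` the half-duplex minus full-duplex rate difference, if
`RSI_D ≥ N_D`, `RSI_U ≥ N_U` with at least one strict, then `f` is strictly positive on
some interval `(0, ξ₀)`: low-received-power users do better in half-duplex. -/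
theorem hybrid_duplex_half_better_near_zero
    (ND NU RD RU ε : ℝ) (hND : 0 < ND) (hNU : 0 < NU) (hRD : 0 ≤ RD) (hRU : 0 ≤ RU)
    (hε : 0 < ε) (hD : ND ≤ RD) (hU : NU ≤ RU) (hstrict : ND < RD ∨ NU < RU)
    (f : ℝ → ℝ)
    (hf : f = fun ξ => (1/2) * Real.log (1 + ξ / ND) + (1/2) * Real.log (1 + ε * ξ / NU)
      - Real.log (1 + ξ / (RD + ND)) - Real.log (1 + ε * ξ / (RU + NU))) :
    ∃ ξ₀ > 0, ∀ ξ, 0 < ξ → ξ < ξ₀ → 0 < f ξ := by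
  have h_deriv : HasDerivAt f
      (1 / 2 * (1 / ND) + 1 / 2 * (ε / NU) - 1 / (RD + ND) - ε / (RU + NU)) 0 := by
    have h := ((((hasDerivAt_log_one_add_mul_div_zero 1 ND).const_mul (1 / 2)).add
      ((hasDerivAt_log_one_add_mul_div_zero ε NU).const_mul (1 / 2))).sub
      (hasDerivAt_log_one_add_mul_div_zero 1 (RD + ND))).sub
      (hasDerivAt_log_one_add_mul_div_zero ε (RU + NU))
    simp only [one_mul] at h
    rw [hf]
    exact h
  refine exists_pos_forall_pos_of_hasDerivAt_zero h_deriv (by simp [hf]) ?_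
  have h_down := div_add_le_half_mul_div one_pos hND hD
  have h_up := div_add_le_half_mul_div hε hNU hU
  rcases hstrict with h | h
  · linarith [div_add_lt_half_mul_div one_pos hND h]
  · linarith [div_add_lt_half_mul_div hε hNU h]
end
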